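/- arXiv:1407.5298 — 3 statements merged into one kernel-verified Lean document; each statement's English description precedes it below -/
import Mathlib

section
/- Let Y_1,…,Y_n be real numbers in the interval [0,M] with M > 0, let S be a uniformly random s-element subset of {1,…,n}, let Y_S = Σ_{i∈S} Y_i, and let μ = (1/n)·Σ_{i=1}^n Y_i. Then for every τ > 0, Pr(|Y_S − s·μ| ≥ τ) ≤ 2·exp(−τ²/(M·(4·s·μ + τ))). -/
noncomputable section

/-- fraction of the `binomial(n,s)` subsets of `{1,…,n}` of size `s` satisfying `P`. -/
def subsetFrac (n s : ℕ) (P : Finset (Fin n) → Prop) : ℝ :=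
  (Nat.card {S : Finset (Fin n) // S.card = s ∧ P S} : ℝ) /
    (Nat.card {S : Finset (Fin n) // S.card = s} : ℝ)

def esy (n k : ℕ) (x : Fin n → ℝ) : ℝ :=
  ∑ S ∈ Finset.powersetCard k (Finset.univ : Finset (Fin n)), ∏ i ∈ S, x i

def wsy (n k : ℕ) (x : Fin n → ℝ) (j : Fin n) : ℝ :=
  ∑ S ∈ (Finset.powersetCard k (Finset.univ : Finset (Fin n))).filter (fun S => j ∈ S), ∏ i ∈ S, x i

lemma wsy_mono (n k : ℕ) (x : Fin n → ℝ) (hx : ∀ i, 0 ≤ x i) : Monovary (wsy n k x) x := by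
  intro i j hij
  have h : wsy n k x j = ∑ S ∈ (Finset.powersetCard k (Finset.univ : Finset (Fin n))).filter (fun S => i ∈ S), ∏ l ∈ S, x (Equiv.swap i j l) := by
    unfold wsy
    symm
    refine Finset.sum_bij' (fun S _ => S.map (Equiv.swap i j).toEmbedding)
      (fun S _ => S.map (Equiv.swap i j).toEmbedding) ?_ ?_ ?_ ?_ ?_
    · intro S hS
      simp only [Finset.mem_filter, Finset.mem_powersetCard_univ, Finset.card_map] at hS ⊢
      refine ⟨hS.1, ?_⟩
      rw [Finset.mem_map]
      exact ⟨i, hS.2, by simp⟩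
    · intro S hS
      simp only [Finset.mem_filter, Finset.mem_powersetCard_univ, Finset.card_map] at hS ⊢
      refine ⟨hS.1, ?_⟩
      rw [Finset.mem_map]
      exact ⟨j, hS.2, by simp⟩
    · intro S hS
      rw [Finset.map_map]
      ext a; simp
    · intro S hS
      rw [Finset.map_map]
      ext a; simp
    · intro S hS
      rw [Finset.prod_map]
      rfl
  rw [h]
  unfold wsy
  apply Finset.sum_le_sum
  intro S hS
  have hi := (Finset.mem_filter.1 hS).2
  by_cases hj : j ∈ S
  · apply le_of_eq
    symm
    refine Finset.prod_equiv (Equiv.swap i j) ?_ ?_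
    · intro l
      by_cases h1 : l = i
      · subst h1; simp [hi, hj]
      by_cases h2 : l = j
      · subst h2; simp [hi, hj]
      rw [Equiv.swap_apply_of_ne_of_ne h1 h2]
    · intro l _; rfl
  · apply Finset.prod_le_prod
    · intro l _; exact hx l
    · intro l hl
      by_cases h1 : l = i
      · subst h1; simp [hij.le]
      by_cases h2 : l = j
      · subst h2; exact absurd hl hj
      rw [Equiv.swap_apply_of_ne_of_ne h1 h2]

lemma sum_wsy (n k : ℕ) (x : Fin n → ℝ) : ∑ j, wsy n k x j = k * esy n k x := by
  unfold wsy esy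
  simp_rw [Finset.sum_filter]
  rw [Finset.sum_comm, Finset.mul_sum]
  apply Finset.sum_congr rfl
  intro S hS
  rw [Finset.mem_powersetCard_univ] at hS
  simp [hS]

lemma sum_wsy_mul (n k : ℕ) (x : Fin n → ℝ) : ∑ j, wsy n k x j * x j =
    ∑ S ∈ Finset.powersetCard k (Finset.univ : Finset (Fin n)), (∏ i ∈ S, x i) * ∑ j ∈ S, x j := by
  unfold wsy
  simp_rw [Finset.sum_filter, Finset.sum_mul]
  rw [Finset.sum_comm]
  apply Finset.sum_congr rfl
  intro S hS
  simp [Finset.mul_sum, ite_mul, Finset.sum_ite_mem]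

lemma esy_succ (n k : ℕ) (x : Fin n → ℝ) : ((k + 1 : ℕ) : ℝ) * esy n (k+1) x =
    ∑ S ∈ Finset.powersetCard k (Finset.univ : Finset (Fin n)), (∏ i ∈ S, x i) * ∑ j ∈ Sᶜ, x j := by
  rw [← sum_wsy]
  simp_rw [Finset.mul_sum]
  unfold wsy
  rw [Finset.sum_sigma', Finset.sum_sigma']
  refine Finset.sum_bij' (fun p _ => ⟨p.2.erase p.1, p.1⟩) (fun p _ => ⟨p.2, insert p.2 p.1⟩) ?_ ?_ ?_ ?_ ?_
  · rintro ⟨j, S⟩ h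
    simp at h ⊢
    rw [Finset.card_erase_of_mem h.2]; omega
  · rintro ⟨S, j⟩ h
    simp at h ⊢
    rw [Finset.card_insert_of_notMem h.2]; omega
  · rintro ⟨j, S⟩ h
    simp at h ⊢
    exact Finset.insert_erase h.2
  · rintro ⟨S, j⟩ h
    simp at h ⊢
    exact h.2
  · rintro ⟨j, S⟩ h
    simp at h ⊢
    rw [Finset.prod_erase_mul _ _ h.2]

lemma esy_step (n k : ℕ) (x : Fin n → ℝ) (hx : ∀ i, 0 ≤ x i) :
    ((k + 1 : ℕ) : ℝ) * esy n (k+1) x * n ≤ (n - k) * (∑ i, x i) * esy n k x := by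
  have h1 := (wsy_mono n k x hx).sum_mul_sum_le_card_mul_sum
  rw [sum_wsy, sum_wsy_mul] at h1
  have h2 : ((k + 1 : ℕ) : ℝ) * esy n (k+1) x = esy n k x * (∑ i, x i) -
      ∑ S ∈ Finset.powersetCard k (Finset.univ : Finset (Fin n)), (∏ i ∈ S, x i) * ∑ j ∈ S, x j := by
    rw [esy_succ, esy, Finset.sum_mul, ← Finset.sum_sub_distrib]
    apply Finset.sum_congr rfl
    intro S _
    rw [← Finset.sum_add_sum_compl S x]; ring
  rw [h2]
  simp only [Fintype.card_fin] at h1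
  nlinarith [h1]

lemma maclaurin (n s : ℕ) (hn : 0 < n) (hs : s ≤ n) (x : Fin n → ℝ) (hx : ∀ i, 0 ≤ x i) :
    esy n s x ≤ n.choose s * ((∑ i, x i) / n) ^ s := by
  induction s with
  | zero => simp [esy]
  | succ k ih =>
    have ih := ih (by omega)
    have h := esy_step n k x hx
    have hn' : (0:ℝ) < n := by exact_mod_cast hn
    have hk : (k:ℝ) + 1 ≤ n := by exact_mod_cast hs
    have hc : (n.choose (k+1) : ℝ) * (k+1) = n.choose k * (n - k) := by
      have := Nat.choose_succ_right_eq n k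
      have h2 : ((n - k : ℕ) : ℝ) = n - k := by rw [Nat.cast_sub (by omega)]
      rw [← h2]
      exact_mod_cast this
    have hX : 0 ≤ ∑ i, x i := Finset.sum_nonneg fun i _ => hx i
    have hpos : (0:ℝ) < (k+1) * n := by positivity
    refine le_of_mul_le_mul_left ?_ hpos
    calc ((k:ℝ)+1) * n * esy n (k+1) x = ((k + 1 : ℕ) : ℝ) * esy n (k+1) x * n := by push_cast; ring
      _ ≤ (n - k) * (∑ i, x i) * esy n k x := h
      _ ≤ (n - k) * (∑ i, x i) * (n.choose k * ((∑ i, x i) / n) ^ k) := by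
        apply mul_le_mul_of_nonneg_left ih
        apply mul_nonneg _ hX
        linarith
      _ = (n.choose k * (n - k)) * ((∑ i, x i) * ((∑ i, x i) / n) ^ k) := by ring
      _ = _ := by
        rw [← hc, pow_succ]
        field_simp

lemma exp_aux (t : ℝ) (ht : 0 ≤ t) : (Real.exp t - 1 - t) * (1 - t / 2) ≤ t ^ 2 / 2 := by
  have hd : ∀ y : ℝ, HasDerivAt (fun y : ℝ => (1 - y/2) * Real.exp y - y/2)
      ((-(1/2)) * Real.exp y + (1 - y/2) * Real.exp y - 1/2) y := by
    intro y
    have h1 : HasDerivAt (fun y : ℝ => 1 - y/2) (-(1/2)) y := ((hasDerivAt_id y).div_const 2).const_sub 1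
    have h2 : HasDerivAt (fun y : ℝ => y/2) (1/2) y := ((hasDerivAt_id y).div_const 2)
    exact (h1.mul (Real.hasDerivAt_exp y)).sub h2
  have ha : Antitone (fun y : ℝ => (1 - y/2) * Real.exp y - y/2) := by
    apply antitone_of_deriv_nonpos (fun y => (hd y).differentiableAt)
    intro y
    rw [(hd y).deriv]
    have h1 := Real.add_one_le_exp (-y)
    have h2 : Real.exp (-y) * Real.exp y = 1 := by rw [← Real.exp_add]; simp
    nlinarith [Real.exp_pos y]
  have := ha ht
  simp at this
  nlinarith

/-- numeric bound -/
lemma num_aux (m a : ℝ) (hm : 0 ≤ m) (ha : 0 < a) (t : ℝ) (ht : t = 2 * a / (4 * m + a)) :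
    m * (Real.exp t - 1 - t) - t * a ≤ - (a ^ 2 / (4 * m + a)) := by
  have hd : 0 < 4 * m + a := by positivity
  have ht0 : 0 ≤ t := by rw [ht]; positivity
  have h := exp_aux t ht0
  have h1 : 1 - t / 2 = 4 * m / (4 * m + a) := by rw [ht]; field_simp; ring
  have h2 : t * (4 * m + a) = 2 * a := by rw [ht]; field_simp
  rw [h1] at h
  have h3 : m * (Real.exp t - 1 - t) ≤ t ^ 2 * (4 * m + a) / 8 := by
    have := mul_le_mul_of_nonneg_right h hd.le
    have e : (Real.exp t - 1 - t) * (4 * m / (4 * m + a)) * (4 * m + a) = (Real.exp t - 1 - t) * (4 * m) := by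
      field_simp
    rw [e] at this
    linarith
  have h4 : a ^ 2 / (4 * m + a) = t * a / 2 := by rw [ht]; field_simp
  rw [h4]
  have h5 : t ^ 2 * (4 * m + a) = t * (2 * a) := by rw [← h2]; ring
  rw [h5] at h3
  nlinarith [mul_nonneg ht0 ha.le]

lemma num_aux2 (m a : ℝ) (hm : 0 ≤ m) (ha : 0 < a) (t : ℝ) (ht : t = 2 * a / (4 * m + a)) :
    m * (Real.exp (-t) - 1 - (-t)) - t * a ≤ - (a ^ 2 / (4 * m + a)) := by
  have ht0 : 0 ≤ t := by rw [ht]; positivity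
  refine le_trans ?_ (num_aux m a hm ha t ht)
  have := Real.self_le_sinh_iff.2 ht0
  rw [Real.sinh_eq] at this
  have : m * (Real.exp (-t) - 1 - (-t)) ≤ m * (Real.exp t - 1 - t) :=
    mul_le_mul_of_nonneg_left (by linarith) hm
  linarith

lemma mgf {n : ℕ} (hn : 0 < n) (Y : Fin n → ℝ) (M : ℝ) (hM : 0 < M)
    (hY : ∀ i, Y i ∈ Set.Icc 0 M) (s : ℕ) (hs : s ≤ n)
    (μ : ℝ) (hμ : μ = (∑ i, Y i) / n) (u : ℝ) :
    ∑ S ∈ Finset.powersetCard s (Finset.univ : Finset (Fin n)),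
      Real.exp (u / M * ((∑ i ∈ S, Y i) - s * μ)) ≤
      n.choose s * Real.exp (s * μ / M * (Real.exp u - 1 - u)) := by
  have hn' : (0:ℝ) < n := by exact_mod_cast hn
  have h1 := maclaurin n s hn hs (fun i => Real.exp (u / M * Y i)) (fun i => (Real.exp_pos _).le)
  have h2 : (∑ i, Real.exp (u / M * Y i)) / n ≤ Real.exp (μ / M * (Real.exp u - 1)) := by
    refine le_trans ?_ (Real.add_one_le_exp _)
    rw [div_le_iff₀ hn']
    calc (∑ i, Real.exp (u / M * Y i)) ≤ ∑ i, (Y i / M * (Real.exp u - 1) + 1) := by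
          apply Finset.sum_le_sum
          intro i _
          obtain ⟨h0, hm⟩ := hY i
          have hb : Y i / M ≤ 1 := (div_le_one hM).2 hm
          have := convexOn_exp.2 (Set.mem_univ u) (Set.mem_univ 0) (div_nonneg h0 hM.le)
            (sub_nonneg.2 hb) (by ring)
          simp only [smul_eq_mul, mul_zero, add_zero, Real.exp_zero, mul_one] at this
          have e : u / M * Y i = Y i / M * u := by ring
          rw [e]; linarith
      _ = _ := by
          rw [Finset.sum_add_distrib, ← Finset.sum_mul, ← Finset.sum_div, hμ]
          simp
          field_simp
  have h3 : ∑ S ∈ Finset.powersetCard s (Finset.univ : Finset (Fin n)),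
      Real.exp (u / M * ((∑ i ∈ S, Y i) - s * μ)) =
      esy n s (fun i => Real.exp (u / M * Y i)) * Real.exp (-(u / M * (s * μ))) := by
    rw [esy, Finset.sum_mul]
    apply Finset.sum_congr rfl
    intro S _
    rw [← Real.exp_sum, ← Real.exp_add, ← Finset.mul_sum]
    congr 1; ring
  rw [h3]
  calc _ ≤ (n.choose s * Real.exp (μ / M * (Real.exp u - 1)) ^ s) * Real.exp (-(u / M * (s * μ))) := by
        apply mul_le_mul_of_nonneg_right _ (Real.exp_pos _).le
        refine h1.trans ?_
        gcongr
    _ = _ := by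
        rw [← Real.exp_nat_mul, mul_assoc, ← Real.exp_add]
        congr 2; ring

/-- Bernstein's inequality for sampling without replacement. -/
theorem stmt1 {n : ℕ} (Y : Fin n → ℝ) (M : ℝ) (hM : 0 < M)
    (hY : ∀ i, Y i ∈ Set.Icc 0 M) (s : ℕ) (hs : s ≤ n)
    (μ : ℝ) (hμ : μ = (∑ i, Y i) / n) (τ : ℝ) (hτ : 0 < τ) :
    subsetFrac n s (fun S => τ ≤ |(∑ i ∈ S, Y i) - s * μ|) ≤
      2 * Real.exp (-(τ ^ 2 / (M * (4 * s * μ + τ)))) := by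
  classical
  have hμ0 : 0 ≤ μ := by
    rw [hμ]; exact div_nonneg (Finset.sum_nonneg fun i _ => (hY i).1) (Nat.cast_nonneg _)
  have hC : (0:ℝ) < n.choose s := by exact_mod_cast Nat.choose_pos hs
  have hden : Nat.card {S : Finset (Fin n) // S.card = s} = n.choose s := by
    rw [Nat.card_eq_fintype_card, Fintype.card_finset_len, Fintype.card_fin]
  have hnum : Nat.card {S : Finset (Fin n) // S.card = s ∧ τ ≤ |(∑ i ∈ S, Y i) - s * μ|} =
      ((Finset.powersetCard s (Finset.univ : Finset (Fin n))).filter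
        (fun S => τ ≤ |(∑ i ∈ S, Y i) - s * μ|)).card := by
    rw [Nat.card_eq_fintype_card]
    apply Fintype.card_of_subtype
    intro S
    simp
  unfold subsetFrac
  rw [hden, hnum, div_le_iff₀ hC]
  rcases Nat.eq_zero_or_pos n with h0 | hn
  · subst h0
    have : s = 0 := by omega
    subst this
    rw [Finset.filter_eq_empty_iff.2]
    · simp only [Finset.card_empty, Nat.cast_zero]
      positivity
    · intro S _
      have hS : S = ∅ := Finset.eq_empty_of_isEmpty S
      subst hS
      simp [hτ]
  set m := s * μ / M with hm
  set a := τ / M with ha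
  have hm0 : 0 ≤ m := by positivity
  have ha0 : 0 < a := by positivity
  obtain ⟨t, ht⟩ : ∃ t, t = 2 * a / (4 * m + a) := ⟨_, rfl⟩
  have ht0 : 0 ≤ t := by rw [ht]; positivity
  have hfin : a ^ 2 / (4 * m + a) = τ ^ 2 / (M * (4 * s * μ + τ)) := by
    rw [hm, ha]
    have : 0 < 4 * s * μ + τ := by positivity
    have h2 : 4 * (s * μ / M) + τ / M = (4 * s * μ + τ) / M := by ring
    rw [h2]
    field_simp
  have k1 := num_aux m a hm0 ha0 t ht
  have k2 := num_aux2 m a hm0 ha0 t ht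
  rw [hfin] at k1 k2
  have m1 := mgf hn Y M hM hY s hs μ hμ t
  have m2 := mgf hn Y M hM hY s hs μ hμ (-t)
  rw [← hm] at m1 m2
  have key : (((Finset.powersetCard s (Finset.univ : Finset (Fin n))).filter
        (fun S => τ ≤ |(∑ i ∈ S, Y i) - s * μ|)).card : ℝ) ≤
      ∑ S ∈ Finset.powersetCard s (Finset.univ : Finset (Fin n)),
        (Real.exp (t / M * ((∑ i ∈ S, Y i) - s * μ)) * Real.exp (-(t * a)) +
         Real.exp (-t / M * ((∑ i ∈ S, Y i) - s * μ)) * Real.exp (-(t * a))) := by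
    rw [Finset.card_filter, Nat.cast_sum]
    apply Finset.sum_le_sum
    intro S _
    split_ifs with h
    · rw [← Real.exp_add, ← Real.exp_add]
      have e1 : 0 ≤ t / M := by positivity
      have e2 : t * a = t / M * τ := by rw [ha]; ring
      rcases le_abs.1 h with h | h
      · have : 0 ≤ t / M * ((∑ i ∈ S, Y i) - s * μ) + -(t * a) := by
          rw [e2]; nlinarith
        have := Real.one_le_exp this
        have := Real.exp_pos (-t / M * ((∑ i ∈ S, Y i) - s * μ) + -(t * a))
        push_cast; linarith
      · have : 0 ≤ -t / M * ((∑ i ∈ S, Y i) - s * μ) + -(t * a) := by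
          rw [e2, neg_div]; nlinarith
        have := Real.one_le_exp this
        have := Real.exp_pos (t / M * ((∑ i ∈ S, Y i) - s * μ) + -(t * a))
        push_cast; linarith
    · push_cast; positivity
  refine key.trans ?_
  rw [Finset.sum_add_distrib, ← Finset.sum_mul, ← Finset.sum_mul]
  have f : ∀ u A : ℝ, A ≤ n.choose s * Real.exp (m * (Real.exp u - 1 - u)) →
      m * (Real.exp u - 1 - u) - t * a ≤ -(τ ^ 2 / (M * (4 * s * μ + τ))) →
      A * Real.exp (-(t * a)) ≤ n.choose s * Real.exp (-(τ ^ 2 / (M * (4 * s * μ + τ)))) := by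
    intro u A h1 h2
    calc _ ≤ n.choose s * Real.exp (m * (Real.exp u - 1 - u)) * Real.exp (-(t * a)) :=
          mul_le_mul_of_nonneg_right h1 (Real.exp_pos _).le
      _ = n.choose s * Real.exp (m * (Real.exp u - 1 - u) - t * a) := by
          rw [mul_assoc, ← Real.exp_add, ← sub_eq_add_neg]
      _ ≤ _ := by gcongr
  have g1 := f t _ m1 k1
  have g2 := f (-t) _ m2 k2
  linarith

end
end

section
/- Let x_1,…,x_n be real numbers in [0,1], let σ be a uniformly random permutation of {1,…,n}, and set X_i = x_{σ(i)} (sampling without replacement). Assume 1 ≤ k ≤ n/2. Let S_i = X_1 + ⋯ + X_i, let μ = (1/n)·Σ_{i=1}^n x_i, and let s² = (1/n)·Σ_{i=1}^n (x_i − μ)². Then for every α > 0, Pr( max_{1 ≤ i ≤ k} |S_i − i·μ| ≥ α ) ≤ 30·exp( −(α/24)² / (2·k·s² + α/24) ). -/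
noncomputable section

/-- fraction of the `n!` permutations satisfying `P`. -/
def permFrac (n : ℕ) (P : Equiv.Perm (Fin n) → Prop) : ℝ :=
  (Nat.card {σ : Equiv.Perm (Fin n) // P σ} : ℝ) / (Nat.card (Equiv.Perm (Fin n)) : ℝ)

open Finset in
lemma perm_swap_sum {n : ℕ} (F : Equiv.Perm (Fin n) → ℝ) (a b : Fin n) :
    ∑ σ, F (σ * Equiv.swap a b) = ∑ σ, F σ :=
  Equiv.sum_comp (Equiv.mulRight (Equiv.swap a b)) F

/-- initial segment -/
def seg (n i : ℕ) : Finset (Fin n) := Finset.univ.filter (fun j : Fin n => (j : ℕ) < i)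

lemma mem_seg {n i : ℕ} (j : Fin n) : j ∈ seg n i ↔ (j : ℕ) < i := by simp [seg]

lemma seg_succ {n i : ℕ} (h : i < n) : seg n (i + 1) = insert ⟨i, h⟩ (seg n i) := by
  ext j
  simp only [mem_seg, Finset.mem_insert, Fin.ext_iff]
  omega

lemma not_mem_seg {n i : ℕ} (h : i < n) : (⟨i, h⟩ : Fin n) ∉ seg n i := by simp [mem_seg]

lemma swap_seg_ne {n i : ℕ} {a b j : Fin n} (ha : i ≤ (a : ℕ)) (hb : i ≤ (b : ℕ))
    (hj : (j : ℕ) < i) : Equiv.swap a b j = j := by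
  apply Equiv.swap_apply_of_ne_of_ne
  · rintro rfl; omega
  · rintro rfl; omega

lemma macl_step {n : ℕ} (w : Fin n → ℝ) (hw : ∀ i, 0 ≤ w i) (k : ℕ) (hk : k < n) :
    (n : ℝ) * ∑ σ : Equiv.Perm (Fin n), ∏ j ∈ seg n (k + 1), w (σ j) ≤
      (∑ i, w i) * ∑ σ : Equiv.Perm (Fin n), ∏ j ∈ seg n k, w (σ j) := by
  have key : ∀ j : Fin n, ∑ σ : Equiv.Perm (Fin n), ∏ j ∈ seg n (k + 1), w (σ j) ≤
      ∑ σ : Equiv.Perm (Fin n), w (σ j) * ∏ j ∈ seg n k, w (σ j) := by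
    intro j
    simp_rw [seg_succ hk, Finset.prod_insert (not_mem_seg hk)]
    set κ : Fin n := ⟨k, hk⟩ with hκ
    by_cases hj : (j : ℕ) < k
    · have hjm : j ∈ seg n k := (mem_seg j).2 hj
      have hR : ∀ σ : Equiv.Perm (Fin n), ∏ i ∈ seg n k, w (σ i) =
          w (σ j) * ∏ i ∈ (seg n k).erase j, w (σ i) := fun σ =>
        (Finset.mul_prod_erase _ _ hjm).symm
      simp_rw [hR]
      have h1 := perm_swap_sum (fun σ => w (σ j) * (w (σ j) * ∏ i ∈ (seg n k).erase j, w (σ i))) j κ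
      have h2 : ∀ σ : Equiv.Perm (Fin n), ∏ i ∈ (seg n k).erase j, w ((σ * Equiv.swap j κ) i) =
          ∏ i ∈ (seg n k).erase j, w (σ i) := by
        intro σ
        refine Finset.prod_congr rfl fun i hi => ?_
        rw [Finset.mem_erase, mem_seg] at hi
        rw [Equiv.Perm.mul_apply, Equiv.swap_apply_of_ne_of_ne hi.1]
        rintro rfl
        simp [hκ] at hi
      simp only [h2] at h1
      simp only [Equiv.Perm.mul_apply, Equiv.swap_apply_left] at h1
      have h3 : 0 ≤ ∑ σ : Equiv.Perm (Fin n),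
          (w (σ κ) - w (σ j)) ^ 2 * ∏ i ∈ (seg n k).erase j, w (σ i) :=
        Finset.sum_nonneg fun σ _ => mul_nonneg (sq_nonneg _) (Finset.prod_nonneg fun i _ => hw _)
      have h4 : ∑ σ : Equiv.Perm (Fin n),
          (w (σ κ) - w (σ j)) ^ 2 * ∏ i ∈ (seg n k).erase j, w (σ i) =
          ∑ σ : Equiv.Perm (Fin n), w (σ κ) * (w (σ κ) * ∏ i ∈ (seg n k).erase j, w (σ i)) +
          ∑ σ : Equiv.Perm (Fin n), w (σ j) * (w (σ j) * ∏ i ∈ (seg n k).erase j, w (σ i)) -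
          2 * ∑ σ : Equiv.Perm (Fin n), w (σ κ) * (w (σ j) * ∏ i ∈ (seg n k).erase j, w (σ i)) := by
        rw [Finset.mul_sum, ← Finset.sum_add_distrib, ← Finset.sum_sub_distrib]
        refine Finset.sum_congr rfl fun σ _ => ?_
        ring
      linarith
    · push Not at hj
      rw [← perm_swap_sum _ j κ]
      refine Finset.sum_le_sum fun σ _ => le_of_eq ?_
      rw [Equiv.Perm.mul_apply, Equiv.swap_apply_right]
      congr 1
      refine Finset.prod_congr rfl fun i hi => ?_
      rw [mem_seg] at hi
      rw [Equiv.Perm.mul_apply, swap_seg_ne hj (by simp [hκ]) hi]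
  calc (n : ℝ) * ∑ σ : Equiv.Perm (Fin n), ∏ j ∈ seg n (k + 1), w (σ j)
      = ∑ _j : Fin n, ∑ σ : Equiv.Perm (Fin n), ∏ j ∈ seg n (k + 1), w (σ j) := by simp
    _ ≤ ∑ j : Fin n, ∑ σ : Equiv.Perm (Fin n), w (σ j) * ∏ j ∈ seg n k, w (σ j) :=
        Finset.sum_le_sum fun j _ => key j
    _ = _ := by
        rw [Finset.sum_comm, Finset.mul_sum]
        refine Finset.sum_congr rfl fun σ _ => ?_
        rw [← Finset.sum_mul, Equiv.sum_comp σ w]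

lemma macl {n : ℕ} (w : Fin n → ℝ) (hw : ∀ i, 0 ≤ w i) (B : ℝ) (hB : ∑ i, w i ≤ n * B)
    (k : ℕ) (hk : k ≤ n) (hn : 0 < n) :
    ∑ σ : Equiv.Perm (Fin n), ∏ j ∈ seg n k, w (σ j) ≤
      B ^ k * (Nat.card (Equiv.Perm (Fin n)) : ℝ) := by
  have hn' : (0 : ℝ) < n := by exact_mod_cast hn
  have hB0 : 0 ≤ B := by
    have : 0 ≤ n * B := le_trans (Finset.sum_nonneg fun i _ => hw i) hB
    exact nonneg_of_mul_nonneg_right this hn'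
  induction k with
  | zero => simp [seg]
  | succ k ih =>
    have h1 := macl_step w hw k (by omega)
    have h2 := ih (by omega)
    have h0 : 0 ≤ ∑ σ : Equiv.Perm (Fin n), ∏ j ∈ seg n k, w (σ j) :=
      Finset.sum_nonneg fun σ _ => Finset.prod_nonneg fun i _ => hw _
    have h3 := h1.trans (mul_le_mul_of_nonneg_right hB h0)
    rw [mul_assoc] at h3
    have h4 := le_of_mul_le_mul_left h3 hn'
    refine h4.trans ?_
    calc _ ≤ B * (B ^ k * (Nat.card (Equiv.Perm (Fin n)) : ℝ)) := mul_le_mul_of_nonneg_left h2 hB0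
      _ = _ := by ring

/-- partial sums -/
def TT {n : ℕ} (y : Fin n → ℝ) (i : ℕ) (σ : Equiv.Perm (Fin n)) : ℝ := ∑ j ∈ seg n i, y (σ j)

lemma TT_succ {n : ℕ} (y : Fin n → ℝ) (i : ℕ) (h : i < n) (σ : Equiv.Perm (Fin n)) :
    TT y (i + 1) σ = y (σ ⟨i, h⟩) + TT y i σ := by
  rw [TT, seg_succ h, Finset.sum_insert (not_mem_seg h)]; rfl

lemma TT_swap {n : ℕ} (y : Fin n → ℝ) {i m : ℕ} (him : i ≤ m) (σ : Equiv.Perm (Fin n))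
    {a b : Fin n} (ha : m ≤ (a : ℕ)) (hb : m ≤ (b : ℕ)) :
    TT y i (σ * Equiv.swap a b) = TT y i σ := by
  refine Finset.sum_congr rfl fun j hj => ?_
  rw [mem_seg] at hj
  rw [Equiv.Perm.mul_apply, swap_seg_ne ha hb (by omega)]

lemma mart {n : ℕ} (y : Fin n → ℝ) (hy : ∑ i, y i = 0) (i : ℕ) (hi : i < n)
    (g : Equiv.Perm (Fin n) → ℝ)
    (hg : ∀ σ (a b : Fin n), i ≤ (a : ℕ) → i ≤ (b : ℕ) → g (σ * Equiv.swap a b) = g σ) :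
    ∑ σ, g σ * (((n : ℝ) - i) * y (σ ⟨i, hi⟩) + TT y i σ) = 0 := by
  have key : ∀ j ∈ (seg n i)ᶜ, ∑ σ, g σ * (y (σ ⟨i, hi⟩) - y (σ j)) = 0 := by
    intro j hj
    have hj' : i ≤ (j : ℕ) := by simpa [mem_seg] using hj
    have h1 := perm_swap_sum (fun σ => g σ * y (σ j)) j ⟨i, hi⟩
    simp only [hg _ j ⟨i, hi⟩ hj' le_rfl, Equiv.Perm.mul_apply, Equiv.swap_apply_left] at h1
    simp only [mul_sub, Finset.sum_sub_distrib]
    linarith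
  have h2 := Finset.sum_eq_zero key
  rw [Finset.sum_comm] at h2
  rw [← h2]
  refine Finset.sum_congr rfl fun σ _ => ?_
  rw [← Finset.mul_sum, Finset.sum_sub_distrib, Finset.sum_const]
  have hc : ((seg n i)ᶜ.card : ℝ) = (n : ℝ) - i := by
    rw [Finset.card_compl, Fintype.card_fin]
    have : (seg n i).card = i := by
      have : seg n i = Finset.Iio ⟨i, hi⟩ := by
        ext j; simp [mem_seg, Fin.lt_def]
      rw [this]; simp
    rw [this, Nat.cast_sub hi.le]
  have hs : TT y i σ + ∑ j ∈ (seg n i)ᶜ, y (σ j) = 0 := by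
    rw [TT, Finset.sum_add_sum_compl, Equiv.sum_comp σ y, hy]
  rw [nsmul_eq_mul, hc]
  congr 1
  linarith

open Classical in
lemma doob {n : ℕ} (y : Fin n → ℝ) (hy : ∑ i, y i = 0) (α l : ℝ) (hα : 0 < α) (hl : 0 ≤ l)
    (m : ℕ) (hm : m < n) :
    ∑ σ : Equiv.Perm (Fin n), (if ∃ i ≤ m, α ≤ n * (TT y i σ / ((n : ℝ) - i)) then (1 : ℝ) else 0)
        * Real.exp (l * α) ≤
    ∑ σ : Equiv.Perm (Fin n), (if ∃ i ≤ m, α ≤ n * (TT y i σ / ((n : ℝ) - i)) then (1 : ℝ) else 0)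
        * Real.exp (l * (n * (TT y m σ / ((n : ℝ) - m)))) := by
  induction m with
  | zero =>
    refine Finset.sum_le_sum fun σ _ => ?_
    rw [if_neg]
    · simp
    · rintro ⟨i, hi, h⟩
      obtain rfl : i = 0 := by omega
      simp [TT, seg] at h
      linarith
  | succ m ih =>
    have ih := ih (by omega)
    set p : Equiv.Perm (Fin n) → ℝ := fun σ =>
      (if ∃ i ≤ m, α ≤ n * (TT y i σ / ((n : ℝ) - i)) then (1 : ℝ) else 0) with hp
    have hp0 : ∀ σ, 0 ≤ p σ := fun σ => by simp only [hp]; split_ifs <;> norm_num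
    set E : Equiv.Perm (Fin n) → ℝ := fun σ => Real.exp (l * (n * (TT y m σ / ((n : ℝ) - m)))) with hE
    have hps : ∀ σ (a b : Fin n), m ≤ (a : ℕ) → m ≤ (b : ℕ) →
        p (σ * Equiv.swap a b) * E (σ * Equiv.swap a b) = p σ * E σ := by
      intro σ a b ha hb
      simp only [hp, hE]
      rw [TT_swap y le_rfl σ ha hb]
      congr 1
      congr 1
      apply propext
      refine exists_congr fun i => and_congr_right fun him => ?_
      rw [TT_swap y him σ ha hb]
    have hm1 : (0 : ℝ) < (n : ℝ) - (m + 1 : ℕ) := by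
      rw [sub_pos]; exact_mod_cast hm
    have hm0 : (0 : ℝ) < (n : ℝ) - m := by push_cast at hm1; linarith
    have hmart := mart y hy m (by omega) (fun σ => p σ * E σ) hps
    have hstep : ∑ σ, p σ * E σ ≤
        ∑ σ, p σ * Real.exp (l * (n * (TT y (m + 1) σ / ((n : ℝ) - (m + 1 : ℕ))))) := by
      have : ∑ σ, p σ * E σ = ∑ σ, (p σ * E σ + (l * n / (((n : ℝ) - m) * ((n : ℝ) - (m + 1 : ℕ)))) *
          (p σ * E σ * (((n : ℝ) - m) * y (σ ⟨m, by omega⟩) + TT y m σ))) := by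
        rw [Finset.sum_add_distrib, ← Finset.mul_sum, hmart]; ring
      rw [this]
      refine Finset.sum_le_sum fun σ _ => ?_
      set u := l * (n * (TT y m σ / ((n : ℝ) - m))) with hu
      set v := l * (n * (TT y (m + 1) σ / ((n : ℝ) - (m + 1 : ℕ)))) with hv
      have hvu : v - u = (l * n / (((n : ℝ) - m) * ((n : ℝ) - (m + 1 : ℕ)))) *
          (((n : ℝ) - m) * y (σ ⟨m, by omega⟩) + TT y m σ) := by
        rw [hv, hu, TT_succ y m (by omega)]
        field_simp
        push_cast
        ring
      have h1 : Real.exp u * (1 + (v - u)) ≤ Real.exp v := by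
        have := Real.add_one_le_exp (v - u)
        calc _ ≤ Real.exp u * Real.exp (v - u) := by
              apply mul_le_mul_of_nonneg_left _ (Real.exp_pos u).le
              linarith
          _ = _ := by rw [← Real.exp_add]; congr 1; ring
      calc _ = p σ * (Real.exp u * (1 + (v - u))) := by rw [hvu]; simp only [hE]; ring
        _ ≤ _ := mul_le_mul_of_nonneg_left h1 (hp0 σ)
    have h2 : ∀ σ, 
        ((if ∃ i ≤ m + 1, α ≤ n * (TT y i σ / ((n : ℝ) - i)) then (1 : ℝ) else 0) - p σ)
        * Real.exp (l * α) ≤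
        ((if ∃ i ≤ m + 1, α ≤ n * (TT y i σ / ((n : ℝ) - i)) then (1 : ℝ) else 0) - p σ)
        * Real.exp (l * (n * (TT y (m + 1) σ / ((n : ℝ) - (m + 1 : ℕ))))) := by
      intro σ
      by_cases h : ∃ i ≤ m, α ≤ n * (TT y i σ / ((n : ℝ) - i))
      · have h' : ∃ i ≤ m + 1, α ≤ n * (TT y i σ / ((n : ℝ) - i)) := by
          obtain ⟨i, hi, h⟩ := h
          exact ⟨i, by omega, h⟩
        simp only [hp]
        rw [if_pos h, if_pos h']; simp
      · simp only [hp]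
        rw [if_neg h]
        by_cases h' : ∃ i ≤ m + 1, α ≤ n * (TT y i σ / ((n : ℝ) - i))
        · rw [if_pos h']
          obtain ⟨i, hi, h3⟩ := h'
          have : i = m + 1 := by
            by_contra hne
            exact h ⟨i, by omega, h3⟩
          subst this
          have := Real.exp_le_exp.2 (mul_le_mul_of_nonneg_left h3 hl)
          linarith
        · rw [if_neg h']; simp
    have h3 := Finset.sum_le_sum fun σ (_ : σ ∈ Finset.univ) => h2 σ
    simp only [sub_mul, Finset.sum_sub_distrib] at h3
    linarith

lemma one_side {n : ℕ} (y : Fin n → ℝ) (hy : ∑ i, y i = 0) (hy1 : ∀ i, |y i| ≤ 1)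
    (k : ℕ) (hk1 : 1 ≤ k) (hk2 : 2 * k ≤ n) (s2 : ℝ) (hs2 : s2 = (∑ i, (y i) ^ 2) / n)
    (a : ℝ) (ha : 0 < a) :
    permFrac n (fun σ => ∃ i ≤ k, 24 * a ≤ TT y i σ) ≤
      Real.exp (-(a ^ 2 / (2 * k * s2 + a))) := by
  classical
  have hn : 0 < n := by omega
  have hn' : (0 : ℝ) < n := by exact_mod_cast hn
  have hs0 : 0 ≤ s2 := by rw [hs2]; positivity
  set V := k * s2 with hV
  have hV0 : 0 ≤ V := by positivity
  set l := a / (2 * (2 * V + a)) with hl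
  have hl0 : 0 ≤ l := by positivity
  have hl1 : l ≤ 1 / 2 := by
    rw [hl, div_le_div_iff₀ (by positivity) (by norm_num)]; linarith
  have hkn : (2 : ℝ) * k ≤ n := by exact_mod_cast hk2
  have hk0 : (1 : ℝ) ≤ k := by exact_mod_cast hk1
  have hnk : (0 : ℝ) < (n : ℝ) - k := by linarith
  set t := l * n / ((n : ℝ) - k) with ht
  have ht0 : 0 ≤ t := by positivity
  have ht2 : t ≤ 2 * l := by
    rw [ht, div_le_iff₀ hnk]; nlinarith
  have ht1 : t ≤ 1 := by linarith
  have hD := doob y hy (24 * a) l (by linarith) hl0 k (by omega)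
  set N : ℝ := (Nat.card (Equiv.Perm (Fin n)) : ℝ) with hN
  have hN0 : 0 < N := by
    rw [hN]; exact_mod_cast Nat.card_pos
  -- upper bound
  have hM := macl (fun i => Real.exp (t * y i)) (fun i => (Real.exp_pos _).le)
    (Real.exp (t ^ 2 * s2)) (by
      have h1 : ∀ i, Real.exp (t * y i) ≤ 1 + t * y i + t ^ 2 * (y i) ^ 2 := by
        intro i
        have h2 : |t * y i| ≤ 1 := by
          rw [abs_mul, abs_of_nonneg ht0]
          exact mul_le_one₀ ht1 (abs_nonneg _) (hy1 i)
        have h3 := (abs_le.1 (Real.abs_exp_sub_one_sub_id_le h2)).2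
        rw [mul_pow] at h3
        linarith
      calc ∑ i, Real.exp (t * y i) ≤ ∑ i, (1 + t * y i + t ^ 2 * (y i) ^ 2) :=
            Finset.sum_le_sum fun i _ => h1 i
        _ = n * (t ^ 2 * s2 + 1) := by
            rw [Finset.sum_add_distrib, Finset.sum_add_distrib, ← Finset.mul_sum, ← Finset.mul_sum,
              hy, hs2]
            simp
            field_simp
            ring
        _ ≤ _ := mul_le_mul_of_nonneg_left (Real.add_one_le_exp _) hn'.le) k (by omega) hn
  have hE : ∀ σ : Equiv.Perm (Fin n), Real.exp (l * (n * (TT y k σ / ((n : ℝ) - k)))) =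
      ∏ j ∈ seg n k, Real.exp (t * y (σ j)) := by
    intro σ
    rw [← Real.exp_sum, ← Finset.mul_sum, ht, TT]
    congr 1
    ring
  have hup : (∑ σ : Equiv.Perm (Fin n),
      (if ∃ i ≤ k, 24 * a ≤ n * (TT y i σ / ((n : ℝ) - i)) then (1 : ℝ) else 0)) *
      Real.exp (l * (24 * a)) ≤ Real.exp (t ^ 2 * s2) ^ k * N := by
    rw [Finset.sum_mul]
    refine hD.trans (le_trans (Finset.sum_le_sum fun σ _ => ?_) hM)
    rw [← hE]
    split_ifs <;> simp [(Real.exp_pos _).le]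
  have hcard : (Nat.card {σ : Equiv.Perm (Fin n) // ∃ i ≤ k, 24 * a ≤ TT y i σ} : ℝ) ≤
      ∑ σ : Equiv.Perm (Fin n),
      (if ∃ i ≤ k, 24 * a ≤ n * (TT y i σ / ((n : ℝ) - i)) then (1 : ℝ) else 0) := by
    rw [Finset.sum_boole, Nat.card_eq_fintype_card, Fintype.card_subtype]
    rw [Nat.cast_le]
    apply Finset.card_le_card
    intro σ
    simp only [Finset.mem_filter, Finset.mem_univ, true_and]
    rintro ⟨i, hi, h⟩
    refine ⟨i, hi, h.trans ?_⟩
    have hi' : (i : ℝ) ≤ k := by exact_mod_cast hi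
    have hni : (0 : ℝ) < (n : ℝ) - i := by linarith
    have : (0 : ℝ) ≤ i := by positivity
    rw [← mul_div_assoc, le_div_iff₀ hni]
    nlinarith
  rw [permFrac, div_le_iff₀ hN0]
  refine hcard.trans ?_
  rw [← le_div_iff₀ (Real.exp_pos _)] at hup
  refine hup.trans ?_
  rw [mul_div_right_comm]
  refine mul_le_mul_of_nonneg_right ?_ hN0.le
  rw [← Real.exp_nat_mul, ← Real.exp_sub]
  apply Real.exp_le_exp.2
  have e1 : (k : ℝ) * (t ^ 2 * s2) ≤ 4 * V * l ^ 2 := by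
    have : t ^ 2 ≤ (2 * l) ^ 2 := pow_le_pow_left₀ ht0 ht2 2
    calc (k : ℝ) * (t ^ 2 * s2) = V * t ^ 2 := by rw [hV]; ring
      _ ≤ V * (2 * l) ^ 2 := mul_le_mul_of_nonneg_left this hV0
      _ = _ := by ring
  have e2 : 2 * (k : ℝ) * s2 + a = 2 * V + a := by rw [hV]; ring
  rw [e2]
  have hW : 0 < 2 * V + a := by linarith
  have e3 : a ^ 2 / (2 * V + a) = 2 * (l * a) := by rw [hl]; field_simp
  rw [e3]
  have e4 : 4 * V * l ^ 2 ≤ l * a := by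
    have : l * (2 * (2 * V + a)) = a := by rw [hl]; field_simp
    nlinarith [mul_nonneg hl0 (mul_nonneg hl0 ha.le)]
  nlinarith [mul_nonneg hl0 ha.le]

lemma permFrac_or {n : ℕ} (P Q R : Equiv.Perm (Fin n) → Prop) (h : ∀ σ, P σ → Q σ ∨ R σ) :
    permFrac n P ≤ permFrac n Q + permFrac n R := by
  classical
  rw [permFrac, permFrac, permFrac, ← add_div]
  refine div_le_div_of_nonneg_right ?_ (Nat.cast_nonneg _)
  simp only [Nat.card_eq_fintype_card, Fintype.card_subtype]
  norm_cast
  refine le_trans (Finset.card_le_card ?_) (Finset.card_union_le _ _)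
  intro σ
  simpa using h σ

/-- maximal Bernstein inequality for sampling without replacement.
`X_i = x_{σ(i)}` and `S_i = X_1 + ⋯ + X_i` is formalized (0-indexed) as the sum of
`x (σ j)` over the indices `j` with `(j : ℕ) < i`. -/
theorem stmt2 {n : ℕ} (x : Fin n → ℝ) (hx : ∀ i, x i ∈ Set.Icc (0 : ℝ) 1)
    (k : ℕ) (hk1 : 1 ≤ k) (hk2 : 2 * k ≤ n)
    (μ s2 : ℝ) (hμ : μ = (∑ i, x i) / n) (hs2 : s2 = (∑ i, (x i - μ) ^ 2) / n)
    (α : ℝ) (hα : 0 < α) :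
    permFrac n (fun σ => ∃ i : ℕ, 1 ≤ i ∧ i ≤ k ∧
        α ≤ |(∑ j ∈ Finset.univ.filter (fun j : Fin n => (j : ℕ) < i), x (σ j)) - i * μ|) ≤
      30 * Real.exp (-((α / 24) ^ 2 / (2 * k * s2 + α / 24))) := by
  have hn' : (0 : ℝ) < n := by exact_mod_cast (by omega : 0 < n)
  have hμ0 : 0 ≤ μ := by
    rw [hμ]; exact div_nonneg (Finset.sum_nonneg fun i _ => (hx i).1) hn'.le
  have hμ1 : μ ≤ 1 := by
    rw [hμ, div_le_one hn']
    calc ∑ i, x i ≤ ∑ _i : Fin n, (1 : ℝ) := Finset.sum_le_sum fun i _ => (hx i).2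
      _ = n := by simp
  have hy : ∑ i, (x i - μ) = 0 := by
    rw [Finset.sum_sub_distrib, hμ]; simp; field_simp; simp
  have hy1 : ∀ i, |x i - μ| ≤ 1 := fun i => by
    have := hx i
    rw [abs_le]; constructor <;> linarith [this.1, this.2]
  have h1 := one_side (fun i => x i - μ) hy hy1 k hk1 hk2 s2 hs2 (α / 24) (by positivity)
  have h2 := one_side (fun i => -(x i - μ)) (by rw [Finset.sum_neg_distrib, hy, neg_zero])
    (fun i => by rw [abs_neg]; exact hy1 i) k hk1 hk2 s2 (by simpa only [neg_sq] using hs2)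
    (α / 24) (by positivity)
  refine (permFrac_or _ _ _ ?_).trans ((add_le_add h1 h2).trans ?_)
  · rintro σ ⟨i, _, hik, h⟩
    have hc : (seg n i).card = i := by
      have : seg n i = Finset.Iio ⟨i, by omega⟩ := by
        ext j; simp [mem_seg, Fin.lt_def]
      rw [this]; simp
    have hT : TT (fun i => x i - μ) i σ =
        (∑ j ∈ Finset.univ.filter (fun j : Fin n => (j : ℕ) < i), x (σ j)) - i * μ := by
      rw [TT, Finset.sum_sub_distrib, Finset.sum_const, hc, nsmul_eq_mul]; rfl
    have hT2 : TT (fun i => -(x i - μ)) i σ = - TT (fun i => x i - μ) i σ := by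
      rw [TT, TT, Finset.sum_neg_distrib]
    rw [← hT] at h
    rcases le_abs.1 h with h | h
    · exact Or.inl ⟨i, hik, by linarith⟩
    · exact Or.inr ⟨i, hik, by rw [hT2]; linarith⟩
  · linarith [Real.exp_pos (-((α / 24) ^ 2 / (2 * k * s2 + α / 24)))]

end
end

section
/- Let {A^t}_{t=1}^n be an (M,γ)-well-bounded generalized load-balancing instance on m ≥ 1 machines with n even, M > 0, γ ≥ 1, and optimal makespan λ*, and let (p*^t)_{t=1}^n be a solution attaining the minimum makespan λ*. Suppose 0 < ε ≤ 1/80, δ ∈ (0, ε], and λ* ≥ 3M·log(m/δ)/ε². Fix a machine i ∈ [m] and let μ = (1/n)·Σ_{t=1}^n (A^t p*^t)_i. Then with probability at least 1 − δ/m² over a uniformly random permutation σ of {1,…,n}, the following holds simultaneously for all t ≤ n/2: | (n·μ − Σ_{j<t} (A^{σ(j)} p*^{σ(j)})_i) / (n − (t−1)) − μ | ≤ 80·ε·( |μ| + γλ*/n ). (The left-hand quantity is the conditional expectation of (A^{σ(t)} p*^{σ(t)})_i given σ(1),…,σ(t−1).) -/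
open Finset

noncomputable section

/-- the max-"norm" `‖v‖_max = max_i v_i` (no absolute values). -/
def vecMax {m : ℕ} (v : Fin m → ℝ) : ℝ := ⨆ i, v i

/-- membership in the simplex `Δ^k`. -/
def inSimplex {k : ℕ} (p : Fin k → ℝ) : Prop := (∀ j, 0 ≤ p j) ∧ ∑ j, p j = 1

/-- makespan of a solution to a generalized load-balancing instance. -/
def makespan {n m k : ℕ} (A : Fin n → Fin m → Fin k → ℝ) (p : Fin n → Fin k → ℝ) : ℝ :=
  vecMax (fun i => ∑ t, ∑ j, A t i j * p t j)

/-- `(M,γ)`-well-bounded load-balancing instance (with `lam` the optimal makespan). -/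
def WellBounded {n m k : ℕ} (A : Fin n → Fin m → Fin k → ℝ) (M γ lam : ℝ) : Prop :=
  (∀ t i j, A t i j ∈ Set.Icc (-M) M) ∧
  ∀ i, (∀ t j, -(γ * lam / n) ≤ A t i j) ∨ (∀ t j, A t i j ≤ γ * lam / n)

/-- partial sums -/
def pS {n : ℕ} (c : Fin n → ℝ) (t : ℕ) (σ : Equiv.Perm (Fin n)) : ℝ :=
  ∑ j ∈ Finset.univ.filter (fun j : Fin n => (j : ℕ) < t), c (σ j)

lemma pS_swap {n : ℕ} (c : Fin n → ℝ) (t : ℕ) (σ : Equiv.Perm (Fin n)) (j j' : Fin n)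
    (hj : t ≤ j) (hj' : t ≤ j') : pS c t (σ * Equiv.swap j j') = pS c t σ := by
  unfold pS
  refine Finset.sum_congr rfl fun l hl => ?_
  have hl' : (l : ℕ) < t := by simpa using hl
  rw [Equiv.Perm.mul_apply, Equiv.swap_apply_of_ne_of_ne]
  · rintro rfl; omega
  · rintro rfl; omega

lemma orth {n : ℕ} (c : Fin n → ℝ) (hc : ∑ j, c j = 0) (t T : ℕ) (htT : t ≤ T) (hT : T < n)
    (w : Equiv.Perm (Fin n) → ℝ)
    (hw : ∀ σ, ∀ j j' : Fin n, t ≤ j → t ≤ j' → w (σ * Equiv.swap j j') = w σ) :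
    ∑ σ, w σ * (pS c T σ / ((n : ℝ) - T)) = ∑ σ, w σ * (pS c t σ / ((n : ℝ) - t)) := by
  have hTn : (T : ℝ) < n := by exact_mod_cast hT
  have htT' : (t : ℝ) ≤ T := by exact_mod_cast htT
  set K : ℝ := ∑ σ, w σ * c (σ ⟨T, hT⟩) with hK
  have hconst : ∀ j : Fin n, t ≤ j → ∑ σ, w σ * c (σ j) = K := by
    intro j hj
    rw [hK, ← Equiv.sum_comp (Equiv.mulRight (Equiv.swap j ⟨T, hT⟩))]
    refine Finset.sum_congr rfl fun σ _ => ?_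
    simp only [Equiv.coe_mulRight]
    rw [hw σ _ _ hj htT]
    simp
  have key : ∀ U : ℕ, t ≤ U → U ≤ n →
      ∑ σ, w σ * pS c U σ = ∑ σ, w σ * pS c t σ + ((U : ℝ) - t) * K := by
    intro U htU hU
    induction U, htU using Nat.le_induction with
    | base => simp
    | succ U htU ih =>
      have hU' : U < n := hU
      have : ∀ σ, pS c (U+1) σ = pS c U σ + c (σ ⟨U, hU'⟩) := by
        intro σ
        unfold pS
        have : (Finset.univ.filter (fun j : Fin n => (j : ℕ) < U + 1))
            = insert ⟨U, hU'⟩ (Finset.univ.filter (fun j : Fin n => (j : ℕ) < U)) := by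
          ext j
          simp [Fin.ext_iff]
          omega
        rw [this, Finset.sum_insert (by simp), add_comm]
      simp only [this, mul_add, Finset.sum_add_distrib]
      rw [ih (by omega), hconst _ htU]
      push_cast
      ring
  have h1 := key T htT hT.le
  have h2 := key n (by omega) le_rfl
  have h3 : ∀ σ, pS c n σ = 0 := by
    intro σ
    unfold pS
    simp only [Fin.is_lt, Finset.filter_true]
    rw [Equiv.sum_comp σ c, hc]
  simp only [h3, mul_zero, Finset.sum_const_zero] at h2
  simp only [← mul_div_assoc]
  rw [← Finset.sum_div, ← Finset.sum_div, h1, div_eq_div_iff (by linarith) (by linarith)]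
  linear_combination (-((T:ℝ) - t)) * h2

lemma maxineq {n : ℕ} (c : Fin n → ℝ) (hc : ∑ j, c j = 0) (T : ℕ) (hT : T < n)
    (θ a : ℝ) (hθ : 0 ≤ θ) :
    ((Finset.univ.filter (fun σ : Equiv.Perm (Fin n) =>
      ∃ t < T, a < pS c t σ / ((n : ℝ) - t))).card : ℝ) * Real.exp (θ * a) ≤
    ∑ σ, Real.exp (θ * (pS c T σ / ((n : ℝ) - T))) := by
  classical
  let Z : ℕ → Equiv.Perm (Fin n) → ℝ := fun t σ => pS c t σ / ((n : ℝ) - t)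
  let B : ℕ → Finset (Equiv.Perm (Fin n)) := fun t => Finset.univ.filter (fun σ =>
      a < Z t σ ∧ ∀ t' < t, ¬ a < Z t' σ)
  have hbad : (Finset.univ.filter (fun σ : Equiv.Perm (Fin n) =>
      ∃ t < T, a < pS c t σ / ((n : ℝ) - t))) = (Finset.range T).biUnion B := by
    ext σ
    simp only [Finset.mem_filter, Finset.mem_univ, true_and, Finset.mem_biUnion,
      Finset.mem_range, B]
    constructor
    · rintro ⟨t, ht, h⟩
      have hex : ∃ t, a < Z t σ := ⟨t, h⟩
      exact ⟨Nat.find hex, lt_of_le_of_lt (Nat.find_min' hex h) ht, Nat.find_spec hex,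
        fun t' ht' => Nat.find_min hex ht'⟩
    · rintro ⟨t, ht, h, _⟩
      exact ⟨t, ht, h⟩
  have hdisj : Set.PairwiseDisjoint (↑(Finset.range T)) B := by
    intro t _ t' _ hne
    refine Finset.disjoint_left.mpr fun σ h h' => ?_
    simp only [Finset.mem_filter, Finset.mem_univ, true_and, B] at h h'
    rcases lt_or_gt_of_ne hne with hl | hl
    · exact h'.2 _ hl h.1
    · exact h.2 _ hl h'.1
  have hone : ∀ t ∈ Finset.range T, ((B t).card : ℝ) * Real.exp (θ * a) ≤
      ∑ σ ∈ B t, Real.exp (θ * Z T σ) := by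
    intro t ht
    have htT : t < T := by simpa using ht
    let w : Equiv.Perm (Fin n) → ℝ := fun σ => if σ ∈ B t then Real.exp (θ * Z t σ) else 0
    have hZ : ∀ σ, ∀ j j' : Fin n, t ≤ j → t ≤ j' → ∀ u ≤ t,
        Z u (σ * Equiv.swap j j') = Z u σ := by
      intro σ j j' hj hj' u hu
      simp only [Z]
      rw [pS_swap c u σ j j' (by omega) (by omega)]
    have hw : ∀ σ, ∀ j j' : Fin n, t ≤ j → t ≤ j' → w (σ * Equiv.swap j j') = w σ := by
      intro σ j j' hj hj'
      have hmem : σ * Equiv.swap j j' ∈ B t ↔ σ ∈ B t := by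
        simp only [Finset.mem_filter, Finset.mem_univ, true_and, B]
        rw [hZ σ j j' hj hj' t le_rfl]
        refine and_congr Iff.rfl (forall_congr' fun u => forall_congr' fun hu => ?_)
        rw [hZ σ j j' hj hj' u hu.le]
      simp only [w, hmem, hZ σ j j' hj hj' t le_rfl]
    have ho := orth c hc t T htT.le hT w hw
    change ∑ σ, w σ * Z T σ = ∑ σ, w σ * Z t σ at ho
    have hwsum : ∀ f : Equiv.Perm (Fin n) → ℝ, ∑ σ, w σ * f σ =
        ∑ σ ∈ B t, Real.exp (θ * Z t σ) * f σ := by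
      intro f
      simp only [w, ite_mul, zero_mul]
      rw [← Finset.sum_filter]
      simp
    rw [hwsum, hwsum] at ho
    calc ((B t).card : ℝ) * Real.exp (θ * a) = ∑ σ ∈ B t, Real.exp (θ * a) := by simp
      _ ≤ ∑ σ ∈ B t, Real.exp (θ * Z t σ) := by
        refine Finset.sum_le_sum fun σ hσ => Real.exp_le_exp.mpr ?_
        simp only [Finset.mem_filter, Finset.mem_univ, true_and, B] at hσ
        exact mul_le_mul_of_nonneg_left hσ.1.le hθ
      _ = ∑ σ ∈ B t, (Real.exp (θ * Z t σ) + θ * (Real.exp (θ * Z t σ) * Z T σ)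
            - θ * (Real.exp (θ * Z t σ) * Z t σ)) := by
        rw [Finset.sum_sub_distrib, Finset.sum_add_distrib, ← Finset.mul_sum, ← Finset.mul_sum, ho]
        ring
      _ ≤ ∑ σ ∈ B t, Real.exp (θ * Z T σ) := by
        refine Finset.sum_le_sum fun σ _ => ?_
        have h1 := Real.add_one_le_exp (θ * Z T σ - θ * Z t σ)
        have h2 : Real.exp (θ * Z T σ) = Real.exp (θ * Z t σ) *
            Real.exp (θ * Z T σ - θ * Z t σ) := by rw [← Real.exp_add]; congr 1; ring
        rw [h2]
        have := mul_le_mul_of_nonneg_left h1 (Real.exp_pos (θ * Z t σ)).le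
        linarith
  rw [hbad, Finset.card_biUnion hdisj]
  push_cast
  rw [Finset.sum_mul]
  refine (Finset.sum_le_sum hone).trans ?_
  rw [← Finset.sum_biUnion hdisj]
  exact Finset.sum_le_sum_of_subset_of_nonneg (Finset.subset_univ _)
    fun _ _ _ => (Real.exp_pos _).le

lemma hybrid {T : ℕ} (c : Fin (T + T) → ℝ) (s : ℝ) (K : Finset (Fin T)) :
    ∑ σ : Equiv.Perm (Fin (T+T)), ∏ j, Real.exp (s * (c (σ (Fin.castAdd T j)) - c (σ (Fin.natAdd T j))))
    = ∑ σ : Equiv.Perm (Fin (T+T)), ∏ j, (if j ∈ K then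
        Real.cosh (s * (c (σ (Fin.castAdd T j)) - c (σ (Fin.natAdd T j)))) else
        Real.exp (s * (c (σ (Fin.castAdd T j)) - c (σ (Fin.natAdd T j))))) := by
  classical
  induction K using Finset.induction_on with
  | empty => simp
  | insert l K hl ih =>
    rw [ih]
    let d : Equiv.Perm (Fin (T+T)) → Fin T → ℝ := fun σ j =>
      s * (c (σ (Fin.castAdd T j)) - c (σ (Fin.natAdd T j)))
    let R : Equiv.Perm (Fin (T+T)) → ℝ := fun σ => ∏ j ∈ Finset.univ.erase l,
      (if j ∈ K then Real.cosh (d σ j) else Real.exp (d σ j))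
    let τ : Equiv.Perm (Fin (T+T)) := Equiv.swap (Fin.castAdd T l) (Fin.natAdd T l)
    have hd : ∀ σ j, j ≠ l → d (σ * τ) j = d σ j := by
      intro σ j hj
      have hj' : (j : ℕ) ≠ l := fun h => hj (Fin.ext h)
      have := j.2
      have := l.2
      simp only [d, τ, Equiv.Perm.mul_apply]
      rw [Equiv.swap_apply_of_ne_of_ne, Equiv.swap_apply_of_ne_of_ne] <;>
        simp [Fin.ext_iff] <;> omega
    have hdl : ∀ σ, d (σ * τ) l = - d σ l := by
      intro σ
      simp only [d, τ, Equiv.Perm.mul_apply, Equiv.swap_apply_left, Equiv.swap_apply_right]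
      ring
    have hR : ∀ σ, R (σ * τ) = R σ := by
      intro σ
      refine Finset.prod_congr rfl fun j hj => ?_
      rw [hd σ j (Finset.ne_of_mem_erase hj)]
    have e1 : ∀ σ, (∏ j, (if j ∈ K then Real.cosh (d σ j) else Real.exp (d σ j)))
        = Real.exp (d σ l) * R σ := by
      intro σ
      rw [← Finset.mul_prod_erase _ _ (Finset.mem_univ l), if_neg hl]
    have e2 : ∀ σ, (∏ j, (if j ∈ insert l K then Real.cosh (d σ j) else Real.exp (d σ j)))
        = Real.cosh (d σ l) * R σ := by
      intro σ
      rw [← Finset.mul_prod_erase _ _ (Finset.mem_univ l), if_pos (Finset.mem_insert_self _ _)]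
      congr 1
      refine Finset.prod_congr rfl fun j hj => ?_
      simp [Finset.mem_insert, Finset.ne_of_mem_erase hj]
    change ∑ σ, (∏ j, (if j ∈ K then Real.cosh (d σ j) else Real.exp (d σ j))) =
      ∑ σ, (∏ j, (if j ∈ insert l K then Real.cosh (d σ j) else Real.exp (d σ j)))
    simp only [e1, e2]
    have e3 : ∑ σ, Real.exp (d σ l) * R σ = ∑ σ, Real.exp (- d σ l) * R σ := by
      rw [← Equiv.sum_comp (Equiv.mulRight τ)]
      refine Finset.sum_congr rfl fun σ _ => ?_
      simp only [Equiv.coe_mulRight]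
      rw [hdl, hR]
    have e4 : ∑ σ, Real.cosh (d σ l) * R σ =
        (∑ σ, Real.exp (d σ l) * R σ + ∑ σ, Real.exp (- d σ l) * R σ) / 2 := by
      rw [← Finset.sum_add_distrib, Finset.sum_div]
      refine Finset.sum_congr rfl fun σ _ => ?_
      rw [Real.cosh_eq]; ring
    rw [e4, ← e3]; ring

lemma mgf_s4 {T : ℕ} (c : Fin (T + T) → ℝ) (hc : ∑ j, c j = 0) (s V : ℝ)
    (hV : ∀ σ : Equiv.Perm (Fin (T+T)),
      ∑ j, (c (σ (Fin.castAdd T j)) - c (σ (Fin.natAdd T j))) ^ 2 ≤ V) :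
    ∑ σ, Real.exp (s * pS c T σ) ≤
      (Fintype.card (Equiv.Perm (Fin (T+T))) : ℝ) * Real.exp (s ^ 2 * V / 8) := by
  have h0 : ∀ σ, Real.exp (s * pS c T σ) = ∏ j, Real.exp (s / 2 *
      (c (σ (Fin.castAdd T j)) - c (σ (Fin.natAdd T j)))) := by
    intro σ
    rw [← Real.exp_sum, ← Finset.mul_sum, Finset.sum_sub_distrib]
    have h1 : ∑ j, c (σ j) = 0 := by rw [Equiv.sum_comp σ c, hc]
    rw [Fin.sum_univ_add] at h1
    have h2 : pS c T σ = ∑ j, c (σ (Fin.castAdd T j)) := by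
      unfold pS
      rw [Finset.sum_filter, Fin.sum_univ_add]
      simp
    rw [h2]
    congr 1
    linear_combination (s/2) * h1
  simp only [h0]
  rw [hybrid c (s/2) Finset.univ]
  have : ∀ σ ∈ (Finset.univ : Finset (Equiv.Perm (Fin (T+T)))), (∏ j, (if j ∈ (Finset.univ : Finset (Fin T)) then
        Real.cosh (s / 2 * (c (σ (Fin.castAdd T j)) - c (σ (Fin.natAdd T j)))) else
        Real.exp (s / 2 * (c (σ (Fin.castAdd T j)) - c (σ (Fin.natAdd T j))))))
        ≤ Real.exp (s ^ 2 * V / 8) := by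
    intro σ _
    simp only [Finset.mem_univ, if_true]
    calc _ ≤ ∏ j, Real.exp ((s / 2 * (c (σ (Fin.castAdd T j)) - c (σ (Fin.natAdd T j)))) ^ 2 / 2) :=
          Finset.prod_le_prod (fun _ _ => (Real.cosh_pos _).le)
            (fun _ _ => Real.cosh_le_exp_half_sq _)
      _ = Real.exp (s ^ 2 / 8 * ∑ j, (c (σ (Fin.castAdd T j)) - c (σ (Fin.natAdd T j))) ^ 2) := by
          rw [← Real.exp_sum, Finset.mul_sum]
          congr 1
          refine Finset.sum_congr rfl fun j _ => ?_
          ring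
      _ ≤ _ := by
          apply Real.exp_le_exp.mpr
          have := mul_le_mul_of_nonneg_left (hV σ) (show 0 ≤ s ^ 2 / 8 by positivity)
          linarith
  refine (Finset.sum_le_card_nsmul _ _ _ this).trans ?_
  simp

lemma tail {T : ℕ} (hT : 0 < T) (c : Fin (T + T) → ℝ) (hc : ∑ j, c j = 0) (s V a : ℝ) (hs : 0 ≤ s)
    (hV : ∀ σ : Equiv.Perm (Fin (T+T)),
      ∑ j, (c (σ (Fin.castAdd T j)) - c (σ (Fin.natAdd T j))) ^ 2 ≤ V) :
    ((Finset.univ.filter (fun σ : Equiv.Perm (Fin (T+T)) =>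
      ∃ t < T, a < pS c t σ / (((T + T : ℕ) : ℝ) - t))).card : ℝ) ≤
    (Fintype.card (Equiv.Perm (Fin (T+T))) : ℝ) * Real.exp (s ^ 2 * V / 8 - s * T * a) := by
  have hT' : (0:ℝ) < T := by exact_mod_cast hT
  have h1 := maxineq c hc T (by omega) (s * T) a (by positivity)
  have h2 := mgf_s4 c hc s V hV
  have h3 : ∀ σ, s * T * (pS c T σ / (((T + T : ℕ) : ℝ) - T)) = s * pS c T σ := by
    intro σ; push_cast; field_simp; ring
  simp only [h3] at h1
  have h4 := h1.trans h2
  rw [← le_div_iff₀ (Real.exp_pos _)] at h4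
  rw [Real.exp_sub, ← mul_div_assoc]
  exact h4

/-- the conditional expectations of the optimal loads are balanced at
every time step of the first half, with high probability.  The time index `t` below is
0-indexed: it corresponds to time `t+1 ∈ {1,…,n/2}` of the 1-indexed statement, so the
inner sum ranges over the first `t` samples and the denominator is `n - t`. -/
theorem stmt4 {n m k : ℕ} (hm : 1 ≤ m) (hn : Even n)
    (A : Fin n → Fin m → Fin k → ℝ) (M γ lamStar ε δ : ℝ)
    (hM : 0 < M) (hγ : 1 ≤ γ)
    (hwb : WellBounded A M γ lamStar)
    (hlam : IsLeast {v : ℝ | ∃ p : Fin n → Fin k → ℝ,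
        (∀ t, inSimplex (p t)) ∧ v = makespan A p} lamStar)
    (pstar : Fin n → Fin k → ℝ) (hps : ∀ t, inSimplex (pstar t))
    (hpsOpt : makespan A pstar = lamStar)
    (hε0 : 0 < ε) (hε1 : ε ≤ 1 / 80) (hδ0 : 0 < δ) (hδε : δ ≤ ε)
    (hlamBig : 3 * M * Real.log ((m : ℝ) / δ) / ε ^ 2 ≤ lamStar)
    (i : Fin m) (μ : ℝ) (hμ : μ = (∑ t, ∑ j, A t i j * pstar t j) / n) :
    1 - δ / (m : ℝ) ^ 2 ≤ permFrac n (fun σ => ∀ t : ℕ, t < n / 2 →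
      |((n : ℝ) * μ -
          ∑ j ∈ Finset.univ.filter (fun j : Fin n => (j : ℕ) < t),
            ∑ jj, A (σ j) i jj * pstar (σ j) jj) / ((n : ℝ) - t) - μ| ≤
        80 * ε * (|μ| + γ * lamStar / n)) := by
  classical
  have hm0 : (1 : ℝ) ≤ m := by exact_mod_cast hm
  obtain ⟨T, rfl⟩ := hn
  have hhalf : (T + T) / 2 = T := by omega
  rw [hhalf]
  set Q : Equiv.Perm (Fin (T + T)) → Prop := fun σ => ∀ t : ℕ, t < T →
      |(((T + T : ℕ) : ℝ) * μ -
          ∑ j ∈ Finset.univ.filter (fun j : Fin (T + T) => (j : ℕ) < t),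
            ∑ jj, A (σ j) i jj * pstar (σ j) jj) / (((T + T : ℕ) : ℝ) - t) - μ| ≤
        80 * ε * (|μ| + γ * lamStar / ((T + T : ℕ) : ℝ)) with hQ
  have hN : (0 : ℝ) < Fintype.card (Equiv.Perm (Fin (T + T))) := by
    exact_mod_cast Fintype.card_pos
  suffices hsuff : ((Finset.univ.filter (fun σ => ¬ Q σ)).card : ℝ) ≤
      (Fintype.card (Equiv.Perm (Fin (T + T))) : ℝ) * (δ / (m : ℝ) ^ 2) by
    have hcard := Finset.card_filter_add_card_filter_not
      (s := (Finset.univ : Finset (Equiv.Perm (Fin (T + T))))) Q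
    rw [Finset.card_univ] at hcard
    have hcard' : ((Finset.univ.filter (fun σ => Q σ)).card : ℝ) +
      ((Finset.univ.filter (fun σ => ¬ Q σ)).card : ℝ) =
      (Fintype.card (Equiv.Perm (Fin (T + T))) : ℝ) := by exact_mod_cast hcard
    unfold permFrac
    rw [Nat.card_eq_fintype_card, Nat.card_eq_fintype_card, Fintype.card_subtype,
      le_div_iff₀ hN]
    linarith
  rcases Nat.eq_zero_or_pos T with hT0 | hT
  · have : (Finset.univ.filter (fun σ => ¬ Q σ)) = ∅ := by
      refine Finset.filter_eq_empty_iff.mpr fun σ _ h => h ?_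
      intro t ht
      omega
    rw [this]
    simp only [Finset.card_empty, Nat.cast_zero]
    positivity
  have hT' : (0 : ℝ) < T := by exact_mod_cast hT
  set N : ℝ := ((T + T : ℕ) : ℝ) with hNdef
  have hNT : N = 2 * T := by rw [hNdef]; push_cast; ring
  have hN0 : 0 < N := by rw [hNT]; positivity
  set x : Fin (T + T) → ℝ := fun t => ∑ j, A t i j * pstar t j with hx
  have hub : ∀ t b, (∀ j, A t i j ≤ b) → x t ≤ b := by
    intro t b hb
    calc x t ≤ ∑ j, b * pstar t j := Finset.sum_le_sum fun j _ =>
          mul_le_mul_of_nonneg_right (hb j) ((hps t).1 j)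
      _ = b := by rw [← Finset.mul_sum, (hps t).2, mul_one]
  have hlb : ∀ t b, (∀ j, b ≤ A t i j) → b ≤ x t := by
    intro t b hb
    calc b = ∑ j, b * pstar t j := by rw [← Finset.mul_sum, (hps t).2, mul_one]
      _ ≤ x t := Finset.sum_le_sum fun j _ =>
          mul_le_mul_of_nonneg_right (hb j) ((hps t).1 j)
  have hsum : ∑ t, x t = N * μ := by
    rw [hμ]; field_simp
  have hell : 0 < Real.log ((m : ℝ) / δ) := by
    apply Real.log_pos
    rw [lt_div_iff₀ hδ0]; linarith
  set ℓ := Real.log ((m : ℝ) / δ) with hℓ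
  have hlam0 : 0 < lamStar := lt_of_lt_of_le (by positivity) hlamBig
  set L : ℝ := N * |μ| + γ * lamStar with hL
  have hLlam : lamStar ≤ L := by
    have h1 : 0 ≤ N * |μ| := by positivity
    nlinarith
  have hL0 : 0 < L := lt_of_lt_of_le hlam0 hLlam
  have habs : ∑ t, |x t| ≤ 2 * L := by
    have hg : ∑ _t : Fin (T + T), 2 * (γ * lamStar / N) = 2 * (γ * lamStar) := by
      rw [Finset.sum_const, Finset.card_univ, Fintype.card_fin, nsmul_eq_mul, ← hNdef]
      field_simp
    have hgn : 0 ≤ γ * lamStar / N := by positivity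
    have hnn : 0 ≤ N * |μ| := by positivity
    rcases hwb.2 i with h | h
    · have h1 : ∀ t, |x t| ≤ x t + 2 * (γ * lamStar / N) := by
        intro t
        have := hlb t _ (h t)
        rw [abs_le]; constructor <;> linarith
      have h2 := Finset.sum_le_sum (s := Finset.univ) fun t _ => h1 t
      rw [Finset.sum_add_distrib, hg, hsum] at h2
      have h3 : N * μ ≤ N * |μ| := mul_le_mul_of_nonneg_left (le_abs_self μ) hN0.le
      linarith
    · have h1 : ∀ t, |x t| ≤ - x t + 2 * (γ * lamStar / N) := by
        intro t
        have := hub t _ (h t)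
        rw [abs_le]; constructor <;> linarith
      have h2 := Finset.sum_le_sum (s := Finset.univ) fun t _ => h1 t
      rw [Finset.sum_add_distrib, hg, Finset.sum_neg_distrib, hsum] at h2
      have h3 : N * (-μ) ≤ N * |μ| := mul_le_mul_of_nonneg_left (neg_le_abs μ) hN0.le
      linarith
  have hxM : ∀ t, |x t| ≤ M := fun t => abs_le.mpr
    ⟨hlb t _ fun j => (hwb.1 t i j).1, hub t _ fun j => (hwb.1 t i j).2⟩
  set c : Fin (T + T) → ℝ := fun t => x t - μ with hcdef
  have hcs : ∑ t, c t = 0 := by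
    simp only [hcdef]
    rw [Finset.sum_sub_distrib, hsum, Finset.sum_const, Finset.card_univ, Fintype.card_fin,
      nsmul_eq_mul, ← hNdef]
    ring
  have hV : ∀ σ : Equiv.Perm (Fin (T+T)),
      ∑ j, (c (σ (Fin.castAdd T j)) - c (σ (Fin.natAdd T j))) ^ 2 ≤ 4 * M * L := by
    intro σ
    have h1 : ∑ j, |x (σ j)| ≤ 2 * L := by
      rw [Equiv.sum_comp σ (fun t => |x t|)]; exact habs
    rw [Fin.sum_univ_add] at h1
    calc _ ≤ ∑ j, 2 * M * (|x (σ (Fin.castAdd T j))| + |x (σ (Fin.natAdd T j))|) := by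
          refine Finset.sum_le_sum fun j _ => ?_
          have e : c (σ (Fin.castAdd T j)) - c (σ (Fin.natAdd T j)) =
            x (σ (Fin.castAdd T j)) - x (σ (Fin.natAdd T j)) := by simp only [hcdef]; ring
          rw [e, ← sq_abs]
          have h2 := abs_sub (x (σ (Fin.castAdd T j))) (x (σ (Fin.natAdd T j)))
          have h3 := hxM (σ (Fin.castAdd T j))
          have h4 := hxM (σ (Fin.natAdd T j))
          have h5 := abs_nonneg (x (σ (Fin.castAdd T j)) - x (σ (Fin.natAdd T j)))
          rw [sq]
          exact mul_le_mul (by linarith) h2 h5 (by positivity)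
      _ = 2 * M * (∑ j, |x (σ (Fin.castAdd T j))| + ∑ j, |x (σ (Fin.natAdd T j))|) := by
          rw [← Finset.mul_sum, Finset.sum_add_distrib]
      _ ≤ 2 * M * (2 * L) := mul_le_mul_of_nonneg_left h1 (by positivity)
      _ = _ := by ring
  set a : ℝ := 80 * ε * (|μ| + γ * lamStar / N) with ha
  have haL : a = 80 * ε * L / (2 * T) := by
    rw [← hNT, ha, hL]; field_simp
  set s : ℝ := 40 * ε / M with hs
  have hs0 : 0 ≤ s := by positivity
  have t1 := tail hT c hcs s (4 * M * L) a hs0 hV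
  have t2 := tail hT (fun t => - c t) (by rw [Finset.sum_neg_distrib, hcs, neg_zero])
    s (4 * M * L) a hs0 (by
      intro σ
      refine le_trans (le_of_eq ?_) (hV σ)
      refine Finset.sum_congr rfl fun j _ => ?_
      ring)
  have hexp : Real.exp (s ^ 2 * (4 * M * L) / 8 - s * T * a) ≤ (δ / m) ^ 3 := by
    have e1 : s ^ 2 * (4 * M * L) / 8 - s * T * a = - (800 * (ε ^ 2 * L / M)) := by
      rw [haL, hs]; field_simp; ring
    have e2 : 3 * ℓ ≤ ε ^ 2 * L / M := by
      rw [div_le_iff₀ (by positivity)] at hlamBig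
      rw [le_div_iff₀ hM]
      nlinarith [sq_nonneg ε, mul_le_mul_of_nonneg_left hLlam (sq_nonneg ε)]
    have e3 : (δ / m) ^ 3 = Real.exp (- (3 * ℓ)) := by
      have : δ / m = Real.exp (- ℓ) := by
        rw [Real.exp_neg, hℓ, Real.exp_log (by positivity), inv_div]
      rw [this, ← Real.exp_nat_mul]
      congr 1; push_cast; ring
    rw [e1, e3]
    apply Real.exp_le_exp.mpr
    linarith
  have hsub : Finset.univ.filter (fun σ => ¬ Q σ) ⊆
      (Finset.univ.filter (fun σ : Equiv.Perm (Fin (T+T)) =>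
        ∃ t < T, a < pS c t σ / (N - t))) ∪
      (Finset.univ.filter (fun σ : Equiv.Perm (Fin (T+T)) =>
        ∃ t < T, a < pS (fun t => - c t) t σ / (N - t))) := by
    intro σ hσ
    simp only [Finset.mem_filter, Finset.mem_univ, true_and, hQ, not_forall, not_le] at hσ
    obtain ⟨t, ht, h⟩ := hσ
    have htT : (t : ℝ) < T := by exact_mod_cast ht
    have hpos : 0 < N - t := by rw [hNT]; linarith
    have hcard : (Finset.univ.filter (fun j : Fin (T + T) => (j : ℕ) < t)).card = t := by
      rw [Fin.card_filter_val_lt]; omega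
    have hp : pS c t σ = ∑ j ∈ Finset.univ.filter (fun j : Fin (T + T) => (j : ℕ) < t),
        x (σ j) - t * μ := by
      simp only [pS, hcdef]
      rw [Finset.sum_sub_distrib, Finset.sum_const, hcard, nsmul_eq_mul]
    have hneg : pS (fun t => - c t) t σ = - pS c t σ := by
      simp only [pS, Finset.sum_neg_distrib]
    have heq : (N * μ - ∑ j ∈ Finset.univ.filter (fun j : Fin (T + T) => (j : ℕ) < t),
        x (σ j)) / (N - t) - μ = - (pS c t σ / (N - t)) := by
      rw [hp]; field_simp; ring
    rw [heq, abs_neg, lt_abs] at h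
    simp only [Finset.mem_union, Finset.mem_filter, Finset.mem_univ, true_and]
    rcases h with h | h
    · exact Or.inl ⟨t, ht, h⟩
    · refine Or.inr ⟨t, ht, ?_⟩
      rw [hneg, neg_div]; exact h
  have hc1 : ((Finset.univ.filter (fun σ => ¬ Q σ)).card : ℝ) ≤
      (Fintype.card (Equiv.Perm (Fin (T + T))) : ℝ) * (δ / m) ^ 3 +
      (Fintype.card (Equiv.Perm (Fin (T + T))) : ℝ) * (δ / m) ^ 3 := by
    have h1 := (Finset.card_le_card hsub).trans (Finset.card_union_le _ _)
    refine le_trans (Nat.cast_le.mpr h1) ?_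
    push_cast
    exact add_le_add (t1.trans (mul_le_mul_of_nonneg_left hexp hN.le))
      (t2.trans (mul_le_mul_of_nonneg_left hexp hN.le))
  refine hc1.trans ?_
  rw [← mul_add]
  refine mul_le_mul_of_nonneg_left ?_ hN.le
  have hδs : 2 * δ ^ 2 ≤ 1 := by nlinarith
  have e : (δ / m) ^ 3 + (δ / m) ^ 3 = (δ / (m : ℝ) ^ 2) * (2 * δ ^ 2 / m) := by
    field_simp; ring
  rw [e]
  refine mul_le_of_le_one_right (by positivity) ?_
  rw [div_le_one (by positivity)]
  linarith


end
end
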